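/- Let M be a finite set-homogeneous a-digraph which is not connected. Then M is isomorphic to K̄_n or to K̄_n[D_3] for some n ≥ 1. -/

import Mathlib

/-- An a-digraph structure: a binary arc relation on the vertex type. -/
structure ADigraph (V : Type*) where
  arc : V → V → Prop

namespace ADigraph

variable {V W : Type*}

/-- The a-digraph axioms: the arc relation is irreflexive and antisymmetric
(no loops, and never arcs in both directions between two vertices). -/
def IsA (M : ADigraph V) : Prop :=
  (∀ v, ¬ M.arc v v) ∧ ∀ u v, M.arc u v → ¬ M.arc v u

/-- Isomorphism of a-digraphs. -/
def Iso (M : ADigraph V) (N : ADigraph W) : Prop :=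
  ∃ e : V ≃ W, ∀ u v, M.arc u v ↔ N.arc (e u) (e v)

/-- Induced subdigraph on a set of vertices. -/
def induce (M : ADigraph V) (S : Set V) : ADigraph S :=
  ⟨fun u v => M.arc (u : V) (v : V)⟩

/-- `g` is an automorphism of `M`. -/
def IsAuto (M : ADigraph V) (g : V ≃ V) : Prop :=
  ∀ u v, M.arc u v ↔ M.arc (g u) (g v)

/-- `M` is set-homogeneous: whenever two finite sets of vertices induce
isomorphic subdigraphs, some automorphism maps one set onto the other. -/
def SetHomogeneous (M : ADigraph V) : Prop :=
  ∀ U U' : Set V, U.Finite → U'.Finite → (M.induce U).Iso (M.induce U') →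
    ∃ g : V ≃ V, M.IsAuto g ∧ ⇑g '' U = U'

/-- `M` is homogeneous: every isomorphism between finite induced subdigraphs
extends to an automorphism. -/
def Homogeneous (M : ADigraph V) : Prop :=
  ∀ U U' : Set V, U.Finite → U'.Finite → ∀ e : U ≃ U',
    (∀ u v : U, M.arc (u : V) (v : V) ↔ M.arc (e u : V) (e v : V)) →
    ∃ g : V ≃ V, M.IsAuto g ∧ ∀ u : U, g (u : V) = (e u : V)

/-- `M` is `k`-homogeneous: every isomorphism between induced subdigraphs of
size `k` extends to an automorphism. -/
def KHomogeneous (M : ADigraph V) (k : ℕ) : Prop :=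
  ∀ U U' : Set V, U.Finite → U'.Finite → U.ncard = k → U'.ncard = k →
    ∀ e : U ≃ U',
      (∀ u v : U, M.arc (u : V) (v : V) ↔ M.arc (e u : V) (e v : V)) →
      ∃ g : V ≃ V, M.IsAuto g ∧ ∀ u : U, g (u : V) = (e u : V)

/-- The directed `n`-cycle `D_n`: vertices `ZMod n`, arcs `i → i + 1`.
(For `n = 1` this is a single vertex with no arcs.) -/
def dirCycle (n : ℕ) : ADigraph (ZMod n) :=
  ⟨fun i j => j = i + 1 ∧ i ≠ j⟩

/-- `K̄_n`: the a-digraph on `n` vertices with no arcs. -/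
def kbar (n : ℕ) : ADigraph (Fin n) :=
  ⟨fun _ _ => False⟩

/-- The a-digraph with no arcs on an arbitrary vertex type. -/
def kbarOn (N : Type*) : ADigraph N :=
  ⟨fun _ _ => False⟩

/-- The compositional product `M[N]`. -/
def comp (M : ADigraph V) (N : ADigraph W) : ADigraph (V × W) :=
  ⟨fun p q => M.arc p.1 q.1 ∨ (p.1 = q.1 ∧ N.arc p.2 q.2)⟩

/-- `M` is connected: any two vertices are joined by a path of arcs,
ignoring orientation. -/
def Connected (M : ADigraph V) : Prop :=
  ∀ u v : V, Relation.ReflTransGen (fun a b => M.arc a b ∨ M.arc b a) u v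

/-- `H₀`: vertices the 8 nonzero vectors of `GF(3)²`, with an arc `u → v` iff
the determinant of the `2 × 2` matrix with columns `u`, `v` equals `1`. -/
def H0 : ADigraph {v : Fin 2 → ZMod 3 // v ≠ 0} :=
  ⟨fun u v => u.1 0 * v.1 1 - u.1 1 * v.1 0 = 1⟩

end ADigraph

open ADigraph

namespace ADigraph

variable {V : Type*} {M : ADigraph V}

open Function Finset
open scoped Pointwise

/-- Set-homogeneity phrased through injective enumerations: tuples with the same arc pattern
have ranges in the same orbit of the automorphism group. -/
def RangeHomogeneous (M : ADigraph V) : Prop :=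
  ∀ (k : ℕ) (f f' : Fin k → V), Injective f → Injective f' →
    (∀ i j, M.arc (f i) (f j) ↔ M.arc (f' i) (f' j)) →
    ∃ g : V ≃ V, M.IsAuto g ∧ ⇑g '' Set.range f = Set.range f'

theorem SetHomogeneous.rangeHomogeneous (h : M.SetHomogeneous) : M.RangeHomogeneous := by
  intro k f f' hf hf' hff
  refine h _ _ (Set.finite_range f) (Set.finite_range f')
    ⟨(Equiv.ofInjective f hf).symm.trans (Equiv.ofInjective f' hf'), ?_⟩
  rintro ⟨_, i, rfl⟩ ⟨_, j, rfl⟩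
  simpa [induce, Equiv.ofInjective_symm_apply] using hff i j

theorem RangeHomogeneous.exists_isAuto_apply_eq (h : M.RangeHomogeneous) (hM : M.IsA) (x y : V) :
    ∃ g : V ≃ V, M.IsAuto g ∧ g x = y := by
  obtain ⟨g, hg, hgr⟩ := h 1 (fun _ => x) (fun _ => y) (injective_of_subsingleton _)
    (injective_of_subsingleton _) (fun _ _ => by simp [hM.1])
  exact ⟨g, hg, by simpa using hgr⟩

theorem IsA.induce (hM : M.IsA) (S : Set V) : (M.induce S).IsA :=
  ⟨fun v => hM.1 v, fun u v => hM.2 u v⟩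

/-- The automorphism group of an a-digraph. -/
def autGroup (M : ADigraph V) : Subgroup (Equiv.Perm V) where
  carrier := {g | M.IsAuto g}
  mul_mem' {a b} ha hb u v := by
    rw [hb u v, ha (b u) (b v)]; rfl
  one_mem' _ _ := Iff.rfl
  inv_mem' {a} ha u v := by
    rw [ha (a⁻¹ u) (a⁻¹ v)]; simp

/-- The relation arises from a tournament: distinct vertices are adjacent. -/
def IsTotal (M : ADigraph V) : Prop :=
  ∀ u v, u ≠ v → M.arc u v ∨ M.arc v u

theorem IsTotal.odd_card_autGroup [Finite V] (ht : M.IsTotal) (hM : M.IsA) :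
    Odd (Nat.card M.autGroup) := by
  by_contra hodd
  rw [Nat.not_odd_iff_even, even_iff_two_dvd] at hodd
  obtain ⟨⟨g, hg⟩, hord⟩ := exists_prime_orderOf_dvd_card' 2 hodd
  rw [orderOf_eq_prime_iff] at hord
  obtain ⟨hsq, hne⟩ := hord
  have hgg : ∀ x, g (g x) = x := fun x => by
    have := congrArg (fun a : M.autGroup => (a : Equiv.Perm V) x) hsq
    simpa [pow_two] using this
  refine hne (Subtype.ext (Equiv.ext fun x => ?_))
  by_contra hx
  have key := hg x (g x)
  rw [hgg] at key
  rcases ht x (g x) (fun h => hx h.symm) with h | h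
  · exact hM.2 _ _ h (key.1 h)
  · exact hM.2 _ _ h (key.2 h)

/-- The vertex sets which can be enumerated with arc pattern `r`. -/
def patternSets (M : ADigraph V) {k : ℕ} (r : Fin k → Fin k → Prop) : Set (Finset V) :=
  {S | ∃ f : Fin k ↪ V, (∀ i j, M.arc (f i) (f j) ↔ r i j) ∧ univ.map f = S}

theorem RangeHomogeneous.odd_ncard_patternSets [Finite V] (h : M.RangeHomogeneous)
    (ht : M.IsTotal) (hM : M.IsA) {k : ℕ} {r : Fin k → Fin k → Prop}
    (hne : (M.patternSets r).Nonempty) : Odd (M.patternSets r).ncard := by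
  classical
  obtain ⟨S, f, hf, rfl⟩ := hne
  have horb : M.patternSets r = MulAction.orbit M.autGroup (univ.map f) := by
    ext S'
    constructor
    · rintro ⟨f', hf', rfl⟩
      obtain ⟨g, hg, hgr⟩ := h k f f' f.injective f'.injective
        (fun i j => (hf i j).trans (hf' i j).symm)
      refine ⟨⟨g, hg⟩, ?_⟩
      rw [← Finset.coe_inj]
      simpa [Subgroup.smul_def, ← Set.image_smul] using hgr
    · rintro ⟨⟨g, hg⟩, rfl⟩
      refine ⟨f.trans g.toEmbedding, fun i j => (hg _ _).symm.trans (hf i j), ?_⟩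
      rw [← Finset.coe_inj]
      ext x
      simp [Subgroup.smul_def, Set.mem_smul_set]
  rw [horb, ← Nat.card_coe_set_eq]
  refine (ht.odd_card_autGroup hM).of_dvd_nat ?_
  rw [Nat.card_congr (MulAction.orbitEquivQuotientStabilizer _ _)]
  exact Subgroup.card_quotient_dvd_card _

theorem patternSets_subset_powersetCard [Fintype V] {k : ℕ} (r : Fin k → Fin k → Prop) :
    M.patternSets r ⊆ (powersetCard k (univ : Finset V) : Set (Finset V)) := by
  rintro _ ⟨f, -, rfl⟩
  simp

/-- The enumeration of a tuple of two distinct vertices. -/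
def pairEmbedding {a b : V} (hab : a ≠ b) : Fin 2 ↪ V :=
  ⟨![a, b], by
    intro i j hij
    fin_cases i <;> fin_cases j <;> simp_all⟩

@[simp]
theorem coe_pairEmbedding {a b : V} (hab : a ≠ b) : ⇑(pairEmbedding hab) = ![a, b] :=
  rfl

/-- The enumeration of a tuple of three distinct vertices. -/
def tripleEmbedding {a b c : V} (hab : a ≠ b) (hac : a ≠ c) (hbc : b ≠ c) : Fin 3 ↪ V :=
  ⟨![a, b, c], by
    intro i j hij
    fin_cases i <;> fin_cases j <;> simp_all⟩

@[simp]
theorem coe_tripleEmbedding {a b c : V} (hab : a ≠ b) (hac : a ≠ c) (hbc : b ≠ c) :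
    ⇑(tripleEmbedding hab hac hbc) = ![a, b, c] :=
  rfl

theorem IsA.ne (hM : M.IsA) {a b : V} (h : M.arc a b) : a ≠ b := by
  rintro rfl
  exact hM.1 _ h

theorem IsA.mem_patternSets_lt (hM : M.IsA) [DecidableEq V] {a b c : V} (hab : M.arc a b)
    (hbc : M.arc b c) (hac : M.arc a c) :
    ({a, b, c} : Finset V) ∈ M.patternSets (fun i j : Fin 3 => i < j) := by
  refine ⟨tripleEmbedding (hM.ne hab) (hM.ne hac) (hM.ne hbc), fun i j => ?_, ?_⟩
  · fin_cases i <;> fin_cases j <;>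
      simp [hM.1, hM.2 _ _ hab, hM.2 _ _ hbc, hM.2 _ _ hac, *]
  · ext x
    simp [Fin.exists_fin_succ, eq_comm]

theorem IsA.mem_patternSets_cycle (hM : M.IsA) [DecidableEq V] {a b c : V} (hab : M.arc a b)
    (hbc : M.arc b c) (hca : M.arc c a) :
    ({a, b, c} : Finset V) ∈ M.patternSets (fun i j : Fin 3 => j = i + 1) := by
  refine ⟨tripleEmbedding (hM.ne hab) (hM.ne hca).symm (hM.ne hbc), fun i j => ?_, ?_⟩
  · fin_cases i <;> fin_cases j <;>
      simp [hM.1, hM.2 _ _ hab, hM.2 _ _ hbc, hM.2 _ _ hca, *]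
  · ext x
    simp [Fin.exists_fin_succ, eq_comm]

theorem IsA.patternSets_one [Fintype V] (hM : M.IsA) :
    M.patternSets (fun _ _ : Fin 1 => False) =
      (powersetCard 1 (univ : Finset V) : Set (Finset V)) := by
  refine (patternSets_subset_powersetCard _).antisymm fun S hS => ?_
  obtain ⟨x, rfl⟩ := Finset.card_eq_one.1 (by simpa using hS : S.card = 1)
  exact ⟨⟨fun _ => x, injective_of_subsingleton _⟩, by simp [hM.1], by ext; simp⟩

theorem IsTotal.patternSets_two [Fintype V] (ht : M.IsTotal) (hM : M.IsA) :
    M.patternSets (fun i j : Fin 2 => i < j) =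
      (powersetCard 2 (univ : Finset V) : Set (Finset V)) := by
  classical
  refine (patternSets_subset_powersetCard _).antisymm fun S hS => ?_
  have main : ∀ a b, M.arc a b → ({a, b} : Finset V) ∈ M.patternSets (fun i j : Fin 2 => i < j) := by
    intro a b hab
    refine ⟨pairEmbedding (hM.ne hab), fun i j => ?_, ?_⟩
    · fin_cases i <;> fin_cases j <;> simp [hM.1, hM.2 _ _ hab, hab]
    · ext x
      simp [eq_comm]
  obtain ⟨x, y, hxy, rfl⟩ := Finset.card_eq_two.1 (by simpa using hS : S.card = 2)
  rcases ht x y hxy with h | h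
  · exact main _ _ h
  · rw [Finset.pair_comm]
    exact main _ _ h

theorem IsTotal.patternSets_three [Fintype V] (ht : M.IsTotal) (hM : M.IsA) :
    M.patternSets (fun i j : Fin 3 => i < j) ∪ M.patternSets (fun i j : Fin 3 => j = i + 1) =
      (powersetCard 3 (univ : Finset V) : Set (Finset V)) := by
  classical
  refine (Set.union_subset (patternSets_subset_powersetCard _)
    (patternSets_subset_powersetCard _)).antisymm fun S hS => ?_
  obtain ⟨x, y, z, hxy, hxz, hyz, rfl⟩ := Finset.card_eq_three.1 (by simpa using hS : S.card = 3)
  have e1 : ({x, y, z} : Finset V) = {x, z, y} := by grind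
  have e2 : ({x, y, z} : Finset V) = {y, x, z} := by grind
  have e3 : ({x, y, z} : Finset V) = {y, z, x} := by grind
  have e4 : ({x, y, z} : Finset V) = {z, x, y} := by grind
  have e5 : ({x, y, z} : Finset V) = {z, y, x} := by grind
  rcases ht x y hxy with h1 | h1 <;> rcases ht x z hxz with h2 | h2 <;>
    rcases ht y z hyz with h3 | h3
  · exact .inl (hM.mem_patternSets_lt h1 h3 h2)
  · exact .inl (e1 ▸ hM.mem_patternSets_lt h2 h3 h1)
  · exact .inr (hM.mem_patternSets_cycle h1 h3 h2)
  · exact .inl (e4 ▸ hM.mem_patternSets_lt h2 h1 h3)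
  · exact .inl (e2 ▸ hM.mem_patternSets_lt h1 h2 h3)
  · exact .inr (e1 ▸ hM.mem_patternSets_cycle h2 h3 h1)
  · exact .inl (e3 ▸ hM.mem_patternSets_lt h3 h2 h1)
  · exact .inl (e5 ▸ hM.mem_patternSets_lt h3 h1 h2)

theorem disjoint_patternSets :
    Disjoint (M.patternSets (fun i j : Fin 3 => i < j))
      (M.patternSets (fun i j : Fin 3 => j = i + 1)) := by
  rw [Set.disjoint_left]
  rintro _ ⟨f, hf, rfl⟩ ⟨f', hf', he⟩
  obtain ⟨i, hi⟩ : ∃ i, f' i = f 2 := by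
    have : f 2 ∈ univ.map f' := by rw [he]; simp
    simpa using this
  obtain ⟨j, hj⟩ : ∃ j, f j = f' (i + 1) := by
    have : f' (i + 1) ∈ univ.map f := by rw [← he]; simp
    simpa using this
  have h := (hf' i (i + 1)).2 rfl
  rw [hi, ← hj, hf] at h
  omega

/-- A finite set-homogeneous tournament with an arc is a directed triangle. -/
theorem RangeHomogeneous.iso_dirCycle_three [Finite V] (h : M.RangeHomogeneous)
    (ht : M.IsTotal) (hM : M.IsA) {u v : V} (huv : M.arc u v) : M.Iso (dirCycle 3) := by
  classical
  have := Fintype.ofFinite V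
  set n := Fintype.card V
  have hn2 : 2 ≤ n := by
    have := Finset.card_le_univ ({u, v} : Finset V)
    rwa [Finset.card_pair (hM.ne huv)] at this
  have h1 : Odd n := by
    have hs := hM.patternSets_one
    have := h.odd_ncard_patternSets ht hM (r := fun _ _ : Fin 1 => False)
      (by rw [hs]; exact ⟨{u}, by simp⟩)
    rw [hs, Set.ncard_coe_finset, card_powersetCard, Nat.choose_one_right] at this
    exact this
  have h2 : Odd (n.choose 2) := by
    have hs := ht.patternSets_two hM
    have := h.odd_ncard_patternSets ht hM (r := fun i j : Fin 2 => i < j)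
      (by rw [hs]; exact ⟨{u, v}, by simp [hM.ne huv]⟩)
    rw [hs, Set.ncard_coe_finset, card_powersetCard] at this
    exact this
  have h3 : Odd (n.choose 3) := by
    have e : n.choose 3 * 3 = n.choose 2 * (n - 2) := Nat.choose_succ_right_eq n 2
    have : Odd (n - 2) := by
      rw [Nat.odd_sub hn2]; simpa using h1
    exact (Nat.odd_mul.1 (e ▸ h2.mul this)).1
  have hsum : (M.patternSets (fun i j : Fin 3 => i < j)).ncard +
      (M.patternSets (fun i j : Fin 3 => j = i + 1)).ncard = n.choose 3 := by
    rw [← Set.ncard_union_eq disjoint_patternSets, ht.patternSets_three hM,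
      Set.ncard_coe_finset, card_powersetCard, card_univ]
  have hcyc : (M.patternSets (fun i j : Fin 3 => j = i + 1)).Nonempty := by
    by_contra hemp
    have htrans : ∀ a b c, M.arc a b → M.arc b c → M.arc a c := by
      intro a b c hab hbc
      have hac : a ≠ c := by
        rintro rfl
        exact hM.2 _ _ hab hbc
      exact (ht a c hac).resolve_right fun hca => hemp ⟨_, hM.mem_patternSets_cycle hab hbc hca⟩
    have : IsTrans V M.arc := ⟨htrans⟩
    have : Std.Irrefl M.arc := ⟨hM.1⟩
    obtain ⟨m, -, hm⟩ := (Finite.wellFounded_of_trans_of_irrefl M.arc).has_min Set.univ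
      ⟨u, trivial⟩
    obtain ⟨g, hg, rfl⟩ := h.exists_isAuto_apply_eq hM v m
    exact hm (g u) trivial ((hg u v).1 huv)
  have htr : ¬ (M.patternSets (fun i j : Fin 3 => i < j)).Nonempty := by
    intro hne
    exact Nat.not_even_iff_odd.2 h3 (hsum ▸ (h.odd_ncard_patternSets ht hM hne).add_odd
      (h.odd_ncard_patternSets ht hM hcyc))
  have hout : ∀ a b c, M.arc a b → M.arc a c → b = c := by
    intro a b c hab hac
    by_contra hbc
    rcases ht b c hbc with h | h
    · exact htr ⟨_, hM.mem_patternSets_lt hab h hac⟩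
    · exact htr ⟨_, hM.mem_patternSets_lt hac h hab⟩
  have hin : ∀ a b c, M.arc b a → M.arc c a → b = c := by
    intro a b c hba hca
    by_contra hbc
    rcases ht b c hbc with h | h
    · exact htr ⟨_, hM.mem_patternSets_lt h hca hba⟩
    · exact htr ⟨_, hM.mem_patternSets_lt h hba hca⟩
  obtain ⟨_, f, hf, -⟩ := hcyc
  have hsurj : Surjective f := by
    intro x
    by_cases hx : x = f 0
    · exact ⟨0, hx.symm⟩
    rcases ht x (f 0) hx with h | h
    · exact ⟨2, hin _ _ _ ((hf 2 0).2 rfl) h⟩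
    · exact ⟨1, hout _ _ _ ((hf 0 1).2 rfl) h⟩
  let e : Fin 3 ≃ V := Equiv.ofBijective f ⟨f.injective, hsurj⟩
  have he : ∀ i, e.symm (f i) = i := e.symm_apply_apply
  refine ⟨e.symm, fun x y => ?_⟩
  obtain ⟨i, rfl⟩ := hsurj x
  obtain ⟨j, rfl⟩ := hsurj y
  change M.arc (f i) (f j) ↔
    e.symm (f j) = e.symm (f i) + 1 ∧ e.symm (f i) ≠ e.symm (f j)
  rw [he, he, hf]
  refine ⟨fun hij => ⟨hij, ?_⟩, fun hij => hij.1⟩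
  subst hij
  revert i
  decide

/-- Reachability along arcs, ignoring orientation. -/
def reachable (M : ADigraph V) : Setoid V where
  r := Relation.ReflTransGen (fun a b => M.arc a b ∨ M.arc b a)
  iseqv :=
    { refl := fun _ => .refl
      symm := fun {a b} h => by
        have : Std.Symm (fun a b => M.arc a b ∨ M.arc b a) := ⟨fun _ _ => Or.symm⟩
        exact Std.Symm.symm _ _ h
      trans := fun h h' => h.trans h' }

theorem reachable_of_arc {a b : V} (h : M.arc a b) : M.reachable a b :=
  Relation.ReflTransGen.single (.inl h)

theorem IsAuto.reachable {g : V ≃ V} (hg : M.IsAuto g) {x y : V} (h : M.reachable x y) :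
    M.reachable (g x) (g y) :=
  Relation.ReflTransGen.lift g (fun a b => Or.imp (hg a b).1 (hg b a).1) _ _ h

/-- In a disconnected set-homogeneous a-digraph, every connected component is a tournament. -/
theorem RangeHomogeneous.adj_of_reachable (h : M.RangeHomogeneous) (hM : M.IsA)
    (hconn : ¬ M.Connected) {x y : V} (hxy : M.reachable x y) (hne : x ≠ y) :
    M.arc x y ∨ M.arc y x := by
  by_contra! hadj
  simp only [Connected, not_forall] at hconn
  obtain ⟨u, v, huv⟩ := hconn
  change ¬ M.reachable u v at huv
  have huv' : u ≠ v := by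
    rintro rfl
    exact huv (M.reachable.refl u)
  have h1 : ¬ M.arc u v := fun h => huv (reachable_of_arc h)
  have h2 : ¬ M.arc v u := fun h => huv (M.reachable.symm (reachable_of_arc h))
  obtain ⟨g, hg, hgr⟩ := h 2 ![x, y] ![u, v] (pairEmbedding hne).injective
    (pairEmbedding huv').injective (fun i j => by
    fin_cases i <;> fin_cases j <;> simp [hM.1, hadj, h1, h2])
  have hr : ∀ z ∈ ⇑g '' Set.range ![x, y], M.reachable (g x) z := by
    rintro _ ⟨_, ⟨i, rfl⟩, rfl⟩
    fin_cases i
    · exact M.reachable.refl _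
    · exact hg.reachable hxy
  rw [hgr] at hr
  exact huv (M.reachable.trans (M.reachable.symm (hr u ⟨0, rfl⟩)) (hr v ⟨1, rfl⟩))

theorem RangeHomogeneous.induce_component (h : M.RangeHomogeneous) (q : Quotient M.reachable) :
    (M.induce {x | Quotient.mk M.reachable x = q}).RangeHomogeneous := by
  intro k f f' hf hf' hff
  obtain _ | k := k
  · exact ⟨Equiv.refl _, fun _ _ => Iff.rfl, by simp [Set.range_eq_empty]⟩
  obtain ⟨g, hg, hgr⟩ := h (k + 1) (fun i => (f i : V)) (fun i => (f' i : V))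
    (Subtype.val_injective.comp hf) (Subtype.val_injective.comp hf') hff
  obtain ⟨j, hj⟩ : g (f 0) ∈ Set.range fun i => (f' i : V) := hgr ▸ ⟨_, ⟨0, rfl⟩, rfl⟩
  have hgq : Quotient.mk M.reachable (g (f 0)) = q := by
    rw [← hj]
    exact (f' j).2
  have hgS : ∀ x, Quotient.mk M.reachable x = q ↔ Quotient.mk M.reachable (g x) = q := by
    intro x
    conv_lhs => rw [← (f 0).2]
    conv_rhs => rw [← hgq]
    rw [Quotient.eq, Quotient.eq]
    refine ⟨hg.reachable, fun hx => ?_⟩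
    have hinv : M.IsAuto g.symm := M.autGroup.inv_mem (x := g) hg
    simpa using hinv.reachable hx
  refine ⟨g.subtypeEquiv hgS, fun u v => hg u v, ?_⟩
  ext y
  constructor
  · rintro ⟨_, ⟨i, rfl⟩, rfl⟩
    obtain ⟨j, hj⟩ : g (f i) ∈ Set.range fun i => (f' i : V) := hgr ▸ ⟨_, ⟨i, rfl⟩, rfl⟩
    exact ⟨j, Subtype.ext hj⟩
  · rintro ⟨j, rfl⟩
    obtain ⟨_, ⟨i, rfl⟩, hi⟩ : (f' j : V) ∈ ⇑g '' Set.range fun i => (f i : V) :=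
      hgr ▸ ⟨j, rfl⟩
    exact ⟨_, ⟨i, rfl⟩, Subtype.ext hi⟩

end ADigraph

/-- A finite set-homogeneous a-digraph which is not
connected is isomorphic to `K̄_n` or `K̄_n[D₃]` for some `n ≥ 1`. -/
theorem finite_set_homogeneous_adigraph_disconnected
    {V : Type} [Fintype V] (M : ADigraph V) (hM : M.IsA)
    (hsh : M.SetHomogeneous) (hconn : ¬ M.Connected) :
    ∃ n : ℕ, 1 ≤ n ∧
      (M.Iso (kbar n) ∨ M.Iso ((kbar n).comp (dirCycle 3))) := by
  classical
  have h := hsh.rangeHomogeneous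
  have hne : Nonempty V := by
    by_contra hemp
    exact hconn fun u => (hemp ⟨u⟩).elim
  by_cases harc : ∃ u v, M.arc u v
  · obtain ⟨u, v, huv⟩ := harc
    have hiso : ∀ q : Quotient M.reachable,
        (M.induce {x | Quotient.mk M.reachable x = q}).Iso (dirCycle 3) := by
      intro q
      obtain ⟨x, rfl⟩ := Quotient.exists_rep q
      obtain ⟨g, hg, rfl⟩ := h.exists_isAuto_apply_eq hM u x
      have hgv : M.arc (g u) (g v) := (hg u v).1 huv
      refine (h.induce_component _).iso_dirCycle_three (fun a b hab => ?_) (hM.induce _)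
        (u := ⟨g u, rfl⟩)
        (v := ⟨g v, Quotient.sound (M.reachable.symm (reachable_of_arc hgv))⟩) hgv
      exact h.adj_of_reachable hM hconn (Quotient.exact (a.2.trans b.2.symm))
        (Subtype.coe_ne_coe.2 hab)
    choose e he using hiso
    have hdep : ∀ (y : V) (q : Quotient M.reachable) (hq : Quotient.mk M.reachable y = q),
        e q ⟨y, hq⟩ = e (Quotient.mk M.reachable y) ⟨y, rfl⟩ := by
      rintro y _ rfl
      rfl
    have : Nonempty (Quotient M.reachable) := ⟨Quotient.mk _ u⟩
    let eQ := Fintype.equivFin (Quotient M.reachable)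
    refine ⟨Fintype.card (Quotient M.reachable), Fintype.card_pos, .inr
      ⟨(Equiv.sigmaFiberEquiv (Quotient.mk M.reachable)).symm.trans
        ((Equiv.sigmaCongrRight e).trans
          ((Equiv.sigmaEquivProd _ _).trans (eQ.prodCongr (Equiv.refl _)))), fun x y => ?_⟩⟩
    have key : M.arc x y ↔ Quotient.mk M.reachable x = Quotient.mk M.reachable y ∧
        (dirCycle 3).arc (e _ ⟨x, rfl⟩) (e _ ⟨y, rfl⟩) := by
      constructor
      · intro hxy
        have hq : Quotient.mk M.reachable y = Quotient.mk M.reachable x :=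
          Quotient.sound (M.reachable.symm (reachable_of_arc hxy))
        refine ⟨hq.symm, ?_⟩
        exact hdep y _ hq ▸ (he _ ⟨x, rfl⟩ ⟨y, hq⟩).1 hxy
      · rintro ⟨hq, hxy⟩
        exact (he _ ⟨x, rfl⟩ ⟨y, hq.symm⟩).2 (hdep y _ hq.symm ▸ hxy)
    rw [key]
    simp [comp, kbar, Equiv.sigmaFiberEquiv]
  · push Not at harc
    exact ⟨Fintype.card V, Fintype.card_pos, .inl
      ⟨Fintype.equivFin V, fun u v => by simp [kbar, harc]⟩⟩
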